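/- For integers d ≥ 1 and 0 ≤ i, j ≤ d−1, the numbers A(d,i,j) counting permutations of {1,…,d} with i descents and last entry d−j satisfy the log-submodularity inequality A(d,i,j+1)·A(d,i+1,j) ≤ A(d,i,j)·A(d,i+1,j+1). -/

import Mathlib

/-- The number of descents of a permutation of `Fin d`:
indices `k` with `σ(k) > σ(k+1)`. -/
def descentCount {d : ℕ} (σ : Equiv.Perm (Fin d)) : ℕ :=
  (Finset.univ.filter
    (fun k : Fin d => ∃ l : Fin d, (l : ℕ) = (k : ℕ) + 1 ∧ σ l < σ k)).card

/-- `A d i j` is the number of permutations `σ` of `{1,…,d}` (modeled on `Fin d`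
with values shifted down by one) with exactly `i` descents and `σ(d) = d - j`,
i.e. the last value (0-based) satisfies `σ(last) + j = d - 1`.  In particular
`A d i j = 0` whenever `i ≥ d` or `j ≥ d`. -/
def permCount (d i j : ℕ) : ℕ :=
  (Finset.univ.filter (fun σ : Equiv.Perm (Fin d) =>
    descentCount σ = i ∧
    ∃ k : Fin d, (k : ℕ) = d - 1 ∧ (σ k : ℕ) + j = d - 1)).card

open Finset

/-- The number of permutations of `Fin (n + 1)` with `i` descents and last value `n - j`, with the
number of descents taken in `ℤ`. -/
def lastValueCount (n : ℕ) (i : ℤ) (j : ℕ) : ℕ :=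
  #{σ : Equiv.Perm (Fin (n + 1)) | (descentCount σ : ℤ) = i ∧ (σ (Fin.last n) : ℕ) + j = n}

theorem permCount_eq_lastValueCount (n i j : ℕ) :
    permCount (n + 1) i j = lastValueCount n i j := by
  unfold permCount lastValueCount
  congr 1
  ext σ
  simp only [mem_filter, mem_univ, true_and, Nat.cast_inj, Nat.add_sub_cancel]
  refine and_congr_right fun _ => ⟨?_, fun h => ⟨Fin.last n, rfl, h⟩⟩
  rintro ⟨k, hk, h⟩
  obtain rfl : k = Fin.last n := Fin.ext hk
  exact h

theorem descentCount_eq_sum {n : ℕ} (σ : Equiv.Perm (Fin (n + 1))) :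
    descentCount σ = ∑ k : Fin n, if σ k.succ < σ k.castSucc then 1 else 0 := by
  unfold descentCount
  rw [card_filter, Fin.sum_univ_castSucc]
  have hlast : ¬ ∃ l : Fin (n + 1), (l : ℕ) = (Fin.last n : ℕ) + 1 ∧ σ l < σ (Fin.last n) := by
    rintro ⟨l, hl, -⟩
    have := l.isLt
    simp only [Fin.val_last] at hl
    omega
  rw [if_neg hlast, add_zero]
  refine sum_congr rfl fun k _ => if_congr ⟨?_, fun h => ⟨k.succ, by simp, h⟩⟩ rfl rfl
  rintro ⟨l, hl, h⟩
  obtain rfl : l = k.succ := Fin.ext (by simpa using hl)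
  exact h

/-- The permutation of `Fin (n + 1)` with last value `p` whose other values are in the same
relative order as those of `τ`. -/
def permSnoc {n : ℕ} (p : Fin (n + 1)) (τ : Equiv.Perm (Fin n)) : Equiv.Perm (Fin (n + 1)) :=
  ((finSuccEquiv' (Fin.last n)).trans (Equiv.optionCongr τ)).trans (finSuccEquiv' p).symm

@[simp]
theorem permSnoc_last {n : ℕ} (p : Fin (n + 1)) (τ : Equiv.Perm (Fin n)) :
    permSnoc p τ (Fin.last n) = p := by
  simp [permSnoc]

@[simp]
theorem permSnoc_castSucc {n : ℕ} (p : Fin (n + 1)) (τ : Equiv.Perm (Fin n)) (k : Fin n) :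
    permSnoc p τ k.castSucc = p.succAbove (τ k) := by
  rw [← Fin.succAbove_last_apply]
  simp only [permSnoc, Equiv.trans_apply, finSuccEquiv'_succAbove]
  simp

theorem permSnoc_bijective (n : ℕ) :
    Function.Bijective fun x : Fin (n + 1) × Equiv.Perm (Fin n) => permSnoc x.1 x.2 := by
  rw [Fintype.bijective_iff_injective_and_card]
  constructor
  · rintro ⟨p, τ⟩ ⟨q, ρ⟩ h
    replace h : permSnoc p τ = permSnoc q ρ := h
    obtain rfl : p = q := by simpa using congrArg (fun σ => σ (Fin.last n)) h
    refine Prod.ext rfl (Equiv.ext fun k => ?_)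
    simpa using congrArg (fun σ => σ k.castSucc) h
  · simp [Fintype.card_perm, Nat.factorial_succ]

theorem descentCount_permSnoc {n : ℕ} (p : Fin (n + 2)) (τ : Equiv.Perm (Fin (n + 1))) :
    descentCount (permSnoc p τ) =
      descentCount τ + if (p : ℕ) ≤ τ (Fin.last n) then 1 else 0 := by
  rw [descentCount_eq_sum, descentCount_eq_sum, Fin.sum_univ_castSucc]
  congr 1
  · refine sum_congr rfl fun k _ => ?_
    rw [← Fin.castSucc_succ, permSnoc_castSucc, permSnoc_castSucc]
    simp [Fin.succAbove_lt_succAbove_iff]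
  · rw [Fin.succ_last, permSnoc_last, permSnoc_castSucc]
    simp [Fin.lt_succAbove_iff_le_castSucc, Fin.le_def]

theorem lastValueCount_succ (n : ℕ) (i : ℤ) (j : ℕ) (hj : j ≤ n + 1) :
    lastValueCount (n + 1) i j =
      ∑ l ∈ range j, lastValueCount n (i - 1) l +
        ∑ l ∈ Ico j (n + 1), lastValueCount n i l := by
  have hsplit : lastValueCount (n + 1) i j =
      #{τ : Equiv.Perm (Fin (n + 1)) | (descentCount τ : ℤ) +
        (if n + 1 ≤ (τ (Fin.last n) : ℕ) + j then 1 else 0) = i} := by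
    unfold lastValueCount
    symm
    refine card_bij (fun τ _ => permSnoc ⟨n + 1 - j, by omega⟩ τ) ?_ ?_ ?_
    · intro τ h
      simp only [mem_filter, mem_univ, true_and] at h ⊢
      rw [descentCount_permSnoc, permSnoc_last]
      refine ⟨?_, by simp; omega⟩
      rw [← h]
      push_cast
      simp
    · intro τ _ ρ _ h
      exact (Prod.ext_iff.1 ((permSnoc_bijective (n + 1)).1
        (a₁ := (⟨n + 1 - j, by omega⟩, τ)) (a₂ := (⟨n + 1 - j, by omega⟩, ρ)) h)).2
    · intro σ h
      obtain ⟨⟨p, τ⟩, rfl⟩ := (permSnoc_bijective (n + 1)).2 σ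
      simp only [mem_filter, mem_univ, true_and, permSnoc_last, descentCount_permSnoc] at h
      obtain ⟨h, hp⟩ := h
      have hp' : p = ⟨n + 1 - j, by omega⟩ := Fin.ext (by simp; omega)
      refine ⟨τ, ?_, by rw [← hp']⟩
      simp only [mem_filter, mem_univ, true_and]
      rw [← h, hp']
      push_cast
      simp
  rw [hsplit, card_eq_sum_card_fiberwise (f := fun τ => n - (τ (Fin.last n) : ℕ))
    (t := range (n + 1)) (fun τ _ => by simp), ← sum_range_add_sum_Ico _ hj]
  congr 1 <;> refine sum_congr rfl fun l hl => ?_ <;> unfold lastValueCount <;> congr 1 <;>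
    ext τ <;> have := (τ (Fin.last n)).isLt <;>
    simp only [mem_filter, mem_univ, true_and, mem_range, mem_Ico] at hl ⊢ <;>
    split_ifs <;> omega

/-- Every `2 × 2` minor on consecutive rows and on the first `n` columns is nonnegative. -/
def MinorsNonneg (n : ℕ) (f : ℤ → ℕ → ℕ) : Prop :=
  ∀ r u v, u ≤ v → v < n → f r v * f (r + 1) u ≤ f r u * f (r + 1) v

/-- Moving two rows toward each other increases products of entries in the first `n` columns. -/
def RowsLogConcave (n : ℕ) (f : ℤ → ℕ → ℕ) : Prop :=
  ∀ r s, r ≤ s → ∀ u v, u < n → v < n → f (r - 1) u * f (s + 1) v ≤ f r u * f s v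

theorem sum_mul_sum_le_sum_mul_sum {S T : Finset ℕ} {a b c e : ℕ → ℕ}
    (h : ∀ u ∈ S, ∀ v ∈ T, a u * b v ≤ c u * e v) :
    (∑ u ∈ S, a u) * ∑ v ∈ T, b v ≤ (∑ u ∈ S, c u) * ∑ v ∈ T, e v := by
  rw [sum_mul_sum, sum_mul_sum]
  exact sum_le_sum fun u hu => sum_le_sum fun v hv => h u hu v hv

section Recursion

variable {n : ℕ} {f g : ℤ → ℕ → ℕ}

theorem MinorsNonneg.sum_mul_sum_le (hT : MinorsNonneg n f) (r : ℤ) {S T : Finset ℕ}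
    (hST : ∀ u ∈ S, ∀ v ∈ T, u ≤ v) (hn : ∀ v ∈ T, v < n) :
    (∑ v ∈ T, f r v) * ∑ u ∈ S, f (r + 1) u ≤ (∑ u ∈ S, f r u) * ∑ v ∈ T, f (r + 1) v := by
  rw [sum_mul_sum, sum_mul_sum, sum_comm]
  exact sum_le_sum fun u hu => sum_le_sum fun v hv => hT r u v (hST u hu v hv) (hn v hv)

theorem RowsLogConcave.sum_mul_sum_le (hC : RowsLogConcave n f) {r s : ℤ} (hrs : r ≤ s)
    {S T : Finset ℕ} (hS : ∀ u ∈ S, u < n) (hT : ∀ v ∈ T, v < n) :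
    (∑ u ∈ S, f (r - 1) u) * ∑ v ∈ T, f (s + 1) v ≤ (∑ u ∈ S, f r u) * ∑ v ∈ T, f s v :=
  sum_mul_sum_le_sum_mul_sum fun u hu v hv => hC r s hrs u v (hS u hu) (hT v hv)

theorem MinorsNonneg.of_recursion (hT : MinorsNonneg n f) (hC : RowsLogConcave n f)
    (hg : ∀ i j, j ≤ n → g i j = ∑ l ∈ range j, f (i - 1) l + ∑ l ∈ Ico j n, f i l) :
    MinorsNonneg (n + 1) g := by
  intro r l j hlj hj
  have hjn : j ≤ n := by omega
  rw [hg r j hjn, hg (r + 1) j hjn, hg r l (by omega), hg (r + 1) l (by omega)]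
  simp only [← sum_range_add_sum_Ico _ hlj, ← sum_Ico_consecutive _ hlj hjn, add_sub_cancel_right]
  have h₁ := hT.sum_mul_sum_le (r - 1) (S := range l) (T := Ico l j)
    (by simp; omega) (by simp; omega)
  rw [sub_add_cancel] at h₁
  have h₂ := hT.sum_mul_sum_le r (S := Ico l j) (T := Ico j n) (by simp; omega) (by simp)
  have h₃ := hC.sum_mul_sum_le (le_refl r) (S := Ico l j) (T := Ico l j)
    (by simp; omega) (by simp; omega)
  have h₄ := hC.sum_mul_sum_le (le_refl r) (S := range l) (T := Ico l j)
    (by simp; omega) (by simp; omega)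
  have h₅ := hC.sum_mul_sum_le (le_refl r) (S := Ico l j) (T := Ico j n)
    (by simp; omega) (by simp)
  linarith

theorem MinorsNonneg.sum_Ico_mul_sum_range_le (hT : MinorsNonneg n f) (r : ℤ) {u v : ℕ}
    (hv : v ≤ n) :
    (∑ l ∈ Ico u n, f r l) * ∑ l ∈ range v, f (r + 1) l ≤
      (∑ l ∈ Ico u n, f (r + 1) l) * ∑ l ∈ range v, f r l := by
  rcases le_total v u with h | h
  · have h₁ := hT.sum_mul_sum_le r (S := range v) (T := Ico u n) (by simp; omega) (by simp)
    linarith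
  · have h₁ := hT.sum_mul_sum_le r (S := range u) (T := Ico u v) (by simp; omega) (by simp; omega)
    have h₂ := hT.sum_mul_sum_le r (S := range u) (T := Ico v n) (by simp; omega) (by simp)
    have h₃ := hT.sum_mul_sum_le r (S := Ico u v) (T := Ico v n) (by simp; omega) (by simp)
    simp only [← sum_range_add_sum_Ico _ h, ← sum_Ico_consecutive _ h hv]
    linarith

theorem RowsLogConcave.of_recursion (hT : MinorsNonneg n f) (hC : RowsLogConcave n f)
    (hg : ∀ i j, j ≤ n → g i j = ∑ l ∈ range j, f (i - 1) l + ∑ l ∈ Ico j n, f i l) :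
    RowsLogConcave (n + 1) g := by
  intro r s hrs u v hu hv
  replace hu : u ≤ n := by omega
  replace hv : v ≤ n := by omega
  rw [hg _ u hu, hg _ u hu, hg _ v hv, hg _ v hv, add_sub_cancel_right]
  have h₁ := hC.sum_mul_sum_le (sub_le_sub_right hrs 1) (S := range u) (T := range v)
    (by simp; omega) (by simp; omega)
  rw [sub_add_cancel] at h₁
  have h₂ := hC.sum_mul_sum_le hrs (S := Ico u n) (T := Ico v n) (by simp) (by simp)
  have h₃ := hC.sum_mul_sum_le (r := r - 1) (s := s) (by omega) (S := range u) (T := Ico v n)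
    (by simp; omega) (by simp)
  have h₄ : (∑ l ∈ Ico u n, f (r - 1) l) * ∑ l ∈ range v, f s l ≤
      (∑ l ∈ Ico u n, f r l) * ∑ l ∈ range v, f (s - 1) l := by
    rcases hrs.eq_or_lt with rfl | hlt
    · simpa using hT.sum_Ico_mul_sum_range_le (r - 1) hv
    · simpa using hC.sum_mul_sum_le (r := r) (s := s - 1) (by omega) (S := Ico u n)
        (T := range v) (by simp) (by simp; omega)
  linarith

end Recursion

theorem lastValueCount_zero (i : ℤ) (j : ℕ) :
    lastValueCount 0 i j = if i = 0 ∧ j = 0 then 1 else 0 := by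
  unfold lastValueCount
  have : Unique (Equiv.Perm (Fin (0 + 1))) := inferInstanceAs (Unique (Equiv.Perm (Fin 1)))
  rw [univ_unique, filter_singleton, descentCount_eq_sum]
  simp [eq_comm, apply_ite card]

theorem lastValueCount_minorsNonneg_and_rowsLogConcave (n : ℕ) :
    MinorsNonneg (n + 1) (lastValueCount n) ∧ RowsLogConcave (n + 1) (lastValueCount n) := by
  induction n with
  | zero =>
    constructor
    · intro r u v huv hv
      obtain rfl : v = 0 := by omega
      obtain rfl : u = 0 := by omega
      rfl
    · intro r s hrs u v hu hv
      rw [lastValueCount_zero, lastValueCount_zero (s + 1)]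
      split_ifs <;> omega
  | succ n ih =>
    exact ⟨ih.1.of_recursion ih.2 (lastValueCount_succ n),
      RowsLogConcave.of_recursion ih.1 ih.2 (lastValueCount_succ n)⟩

theorem permCount_log_submodular (d i j : ℕ) (hd : 1 ≤ d)
    (hi : i ≤ d - 1) (hj : j ≤ d - 1) :
    permCount d i (j + 1) * permCount d (i + 1) j ≤
      permCount d i j * permCount d (i + 1) (j + 1) := by
  obtain ⟨n, rfl⟩ : ∃ n, d = n + 1 := ⟨d - 1, by omega⟩
  simp only [permCount_eq_lastValueCount, Nat.cast_add, Nat.cast_one]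
  rcases hj.eq_or_lt with heq | hlt
  · have h : lastValueCount n i (j + 1) = 0 := by
      unfold lastValueCount
      rw [card_eq_zero, filter_eq_empty_iff]
      intro σ _
      omega
    rw [h, zero_mul]
    exact Nat.zero_le _
  · exact (lastValueCount_minorsNonneg_and_rowsLogConcave n).1 i j (j + 1) (by omega) (by omega)
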